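/- Let spc_G(v,u) denote the number of shortest paths between v and u in G. If edge (a,b) is inserted into G producing G', and for vertices v, u (both distinct from a and b) the distance is unchanged (dist_{G'}(v,u) = dist_G(v,u)) but the count changes (spc_{G'}(v,u) ≠ spc_G(v,u)), then there exists a shortest path from v to u in G' that is not a path in G, and for the penultimate vertex w of such a path, either dist_{G'}(v,w) ≠ dist_G(v,w), or (dist_{G'}(v,w) = dist_G(v,w) and spc_{G'}(v,w) ≠ spc_G(v,w)). -/

import Mathlib

/-- The number of shortest paths between `v` and `u` in `G`. -/
noncomputable def spc {V : Type*} (G : SimpleGraph V) (v u : V) : ℕ :=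
  {p : G.Walk v u | p.IsPath ∧ p.length = G.dist v u}.ncard

theorem spc_aux_ne {V : Type*} {G G' : SimpleGraph V} (hle : G ≤ G') (v w : V)
    (hd : G'.dist v w = G.dist v w) (hr : G.Reachable v w)
    (hfin : {p : G.Walk v w | p.IsPath ∧ p.length = G.dist v w}.Finite)
    (p : G'.Walk v w) (hp : p.IsPath) (hl : p.length = G'.dist v w)
    (hn : ¬ ∀ e ∈ p.edges, e ∈ G.edgeSet) : spc G' v w ≠ spc G v w := by
  unfold spc
  set S := {p : G.Walk v w | p.IsPath ∧ p.length = G.dist v w} with hS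
  set S' := {p : G'.Walk v w | p.IsPath ∧ p.length = G'.dist v w} with hS'
  have hne : S.Nonempty := by
    obtain ⟨q, hq⟩ := hr.exists_walk_length_eq_dist
    exact ⟨q, q.isPath_of_length_eq_dist hq, hq⟩
  have hpos : 0 < S.ncard := (Set.ncard_pos hfin).2 hne
  by_cases hf : S'.Finite
  · have hinj : Function.Injective (fun q : G.Walk v w => q.mapLe hle) :=
      SimpleGraph.Walk.map_injective_of_injective (f := SimpleGraph.Hom.ofLE hle)
        (fun _ _ h => h) v w
    rw [← Set.ncard_image_of_injective S hinj]
    refine (Set.ncard_lt_ncard ?_ hf).ne'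
    refine ⟨?_, fun h => ?_⟩
    · rintro _ ⟨q, hq, rfl⟩
      have : (q.mapLe hle).length = G'.dist v w := by
        rw [hd, ← hq.2]; simp [SimpleGraph.Walk.mapLe]
      exact ⟨SimpleGraph.Walk.isPath_of_length_eq_dist _ this, this⟩
    · obtain ⟨q, hq, rfl⟩ := h (show p ∈ S' from ⟨hp, hl⟩)
      apply hn
      intro e he
      simp only [SimpleGraph.Walk.edges_mapLe_eq_edges] at he
      exact q.edges_subset_edgeSet he
  · rw [Set.Infinite.ncard hf]
    exact hpos.ne

theorem spc_aux_exists {V : Type*} {G G' : SimpleGraph V} (hle : G ≤ G') (v w : V)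
    (hd : G'.dist v w = G.dist v w) (hcnt : spc G' v w ≠ spc G v w) :
    {p : G.Walk v w | p.IsPath ∧ p.length = G.dist v w}.Finite ∧
    ∃ p : G'.Walk v w, p.IsPath ∧ p.length = G'.dist v w ∧
      ¬ ∀ e ∈ p.edges, e ∈ G.edgeSet := by
  unfold spc at hcnt
  set S := {p : G.Walk v w | p.IsPath ∧ p.length = G.dist v w} with hS
  set S' := {p : G'.Walk v w | p.IsPath ∧ p.length = G'.dist v w} with hS'
  have hinj : Function.Injective (fun q : G.Walk v w => q.mapLe hle) :=
    SimpleGraph.Walk.map_injective_of_injective (f := SimpleGraph.Hom.ofLE hle)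
      (fun _ _ h => h) v w
  have hsub : (fun q : G.Walk v w => q.mapLe hle) '' S ⊆ S' := by
    rintro _ ⟨q, hq, rfl⟩
    have : (q.mapLe hle).length = G'.dist v w := by
      rw [hd, ← hq.2]; simp [SimpleGraph.Walk.mapLe]
    exact ⟨SimpleGraph.Walk.isPath_of_length_eq_dist _ this, this⟩
  constructor
  · by_contra hinf
    have h1 : S'.Infinite := (Set.Infinite.image hinj.injOn hinf).mono hsub
    rw [h1.ncard, Set.Infinite.ncard hinf] at hcnt
    exact hcnt rfl
  · by_contra! hall
    apply hcnt
    rw [← Set.ncard_image_of_injective S hinj]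
    congr 1
    refine (hsub.antisymm ?_).symm
    intro p hp
    have he := hall p hp.1 hp.2
    have hlen : (p.transfer G he).length = G.dist v w := by
      rw [SimpleGraph.Walk.length_transfer, hp.2, hd]
    refine ⟨p.transfer G he, ⟨SimpleGraph.Walk.isPath_of_length_eq_dist _ hlen, hlen⟩, ?_⟩
    apply SimpleGraph.Walk.ext_support
    simp

theorem stmt_4 {V : Type*} (G : SimpleGraph V) (a b : V) (hab : a ≠ b)
    (G' : SimpleGraph V) (hG' : G' = G ⊔ SimpleGraph.edge a b) (v u : V)
    (hva : v ≠ a) (hvb : v ≠ b) (hua : u ≠ a) (hub : u ≠ b)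
    (hdist : G'.edist v u = G.edist v u) (hcnt : spc G' v u ≠ spc G v u) :
    ∃ p : G'.Walk v u, p.IsPath ∧ p.length = G'.dist v u ∧
      (¬ ∀ e ∈ p.edges, e ∈ G.edgeSet) ∧
      (∀ w : V, w = p.getVert (p.length - 1) →
        G'.edist v w ≠ G.edist v w ∨
        (G'.edist v w = G.edist v w ∧ spc G' v w ≠ spc G v w)) := by
  have hle : G ≤ G' := hG' ▸ le_sup_left
  have hd : G'.dist v u = G.dist v u := by simp only [SimpleGraph.dist, hdist]
  obtain ⟨hfin, p, hp, hl, hn⟩ := spc_aux_exists hle v u hd hcnt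
  refine ⟨p, hp, hl, hn, ?_⟩
  have hnil : ¬ p.Nil := by
    intro h
    apply hn
    intro e he
    rw [SimpleGraph.Walk.edges_eq_nil.2 h] at he
    simp at he
  have hadj' : G'.Adj p.penultimate u := p.adj_penultimate hnil
  have hadj : G.Adj p.penultimate u := by
    have h := hadj'
    generalize p.penultimate = x at h ⊢
    rw [hG', SimpleGraph.sup_adj, SimpleGraph.edge_adj] at h
    rcases h with h | ⟨⟨_, h⟩ | ⟨_, h⟩, _⟩
    · exact h
    · exact absurd h hub
    · exact absurd h hua
  have hc := p.concat_dropLast hadj'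
  intro w hw
  change w = p.penultimate at hw
  generalize p.dropLast = q at hc
  revert q hadj hadj'
  rw [← hw]
  intro hadj' hadj q hc
  by_cases hdw : G'.edist v w = G.edist v w
  swap
  · exact Or.inl hdw
  refine Or.inr ⟨hdw, ?_⟩
  have hdw' : G'.dist v w = G.dist v w := by simp only [SimpleGraph.dist, hdw]
  have hql : q.length + 1 = G'.dist v u := by
    rw [← hl, ← hc, SimpleGraph.Walk.length_concat]
  have hrw : G.Reachable v w := by
    rw [← SimpleGraph.edist_ne_top_iff_reachable, ← hdw,
      SimpleGraph.edist_ne_top_iff_reachable]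
    exact q.reachable
  have hqd : q.length = G'.dist v w := by
    obtain ⟨r, hr⟩ := q.reachable.exists_walk_length_eq_dist
    have h1 := SimpleGraph.dist_le q
    have h2 := SimpleGraph.dist_le (r.concat hadj')
    rw [SimpleGraph.Walk.length_concat] at h2
    omega
  refine spc_aux_ne hle v w hdw' hrw ?_ q (q.isPath_of_length_eq_dist hqd) hqd ?_
  · refine Set.Finite.of_finite_image (f := fun r : G.Walk v w => r.concat hadj)
      (hfin.subset ?_) ?_
    · rintro _ ⟨r, hr, rfl⟩
      have : (r.concat hadj).length = G.dist v u := by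
        rw [SimpleGraph.Walk.length_concat, hr.2]; omega
      exact ⟨SimpleGraph.Walk.isPath_of_length_eq_dist _ this, this⟩
    · intro r _ s _ h
      obtain ⟨_, h⟩ := SimpleGraph.Walk.concat_inj h
      simpa using h
  · intro hall
    apply hn
    rw [← hc]
    intro e he
    rw [SimpleGraph.Walk.edges_concat, List.concat_eq_append, List.mem_append] at he
    rcases he with he | he
    · exact hall e he
    · rw [List.mem_singleton] at he
      subst he
      exact hadj
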